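/- Let τ > 0, ω > 0, and let β : [-τ, 0] → ℝ be twice continuously differentiable. Define x : [-τ, ∞) → ℝ by x(t) = β(t) for t ∈ [-τ, 0] and, for t ≥ 0, x(t) = β(-τ) cos_τ(ω, t) + (1/ω) β'(-τ) sin_τ(ω, t) + (1/ω) ∫_{-τ}^{0} sin_τ(ω, t - τ - s) β''(s) ds. Then x is continuous on [-τ, ∞), continuously differentiable at t = 0 (i.e., x'(0⁺) = β'(0⁻)), twice differentiable at every t > 0, and satisfies x''(t) + ω² x(t - τ) = 0 for all t > 0. -/

import Mathlib

open Real Set Filter Topology MeasureTheory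

/-- `C` is the delay cosine function `cos_τ(ω, ·)`: it vanishes for `t < -τ` and, for every
integer `k ≥ 0` and `(k-1)τ ≤ t < kτ`, equals
`∑_{j=0}^{k} (-1)^j ω^(2j) (t-(j-1)τ)^(2j) / (2j)!`. -/
def IsDelayCos (τ ω : ℝ) (C : ℝ → ℝ) : Prop :=
  (∀ t : ℝ, t < -τ → C t = 0) ∧
  ∀ (k : ℕ) (t : ℝ), ((k : ℝ) - 1) * τ ≤ t → t < (k : ℝ) * τ →
    C t = ∑ j ∈ Finset.range (k + 1),
      (-1 : ℝ) ^ j * ω ^ (2 * j) * (t - ((j : ℝ) - 1) * τ) ^ (2 * j) / ((2 * j).factorial : ℝ)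

/-- `S` is the delay sine function `sin_τ(ω, ·)`: it vanishes for `t < -τ` and, for every
integer `k ≥ 0` and `(k-1)τ ≤ t < kτ`, equals
`∑_{j=0}^{k} (-1)^j ω^(2j+1) (t-(j-1)τ)^(2j+1) / (2j+1)!`. -/
def IsDelaySin (τ ω : ℝ) (S : ℝ → ℝ) : Prop :=
  (∀ t : ℝ, t < -τ → S t = 0) ∧
  ∀ (k : ℕ) (t : ℝ), ((k : ℝ) - 1) * τ ≤ t → t < (k : ℝ) * τ →
    S t = ∑ j ∈ Finset.range (k + 1),
      (-1 : ℝ) ^ j * ω ^ (2 * j + 1) * (t - ((j : ℝ) - 1) * τ) ^ (2 * j + 1) / ((2 * j + 1).factorial : ℝ)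

theorem hasDerivAt_max_zero_pow (n : ℕ) (y : ℝ) :
    HasDerivAt (fun y : ℝ => max y 0 ^ (n + 2)) ((n + 2 : ℝ) * max y 0 ^ (n + 1)) y := by
  have hpow : HasDerivAt (fun y : ℝ => y ^ (n + 2)) ((n + 2 : ℝ) * y ^ (n + 1)) y := by
    simpa using hasDerivAt_pow (n + 2) y
  rcases lt_trichotomy y 0 with hy | rfl | hy
  · rw [max_eq_right hy.le]
    refine HasDerivAt.congr_of_eventuallyEq (f := fun _ => (0 : ℝ)) ?_ ?_
    · simpa using hasDerivAt_const y (0 : ℝ)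
    · filter_upwards [Iio_mem_nhds hy] with z hz
      simp [max_eq_right (mem_Iio.1 hz).le]
  · rw [← hasDerivWithinAt_univ, ← Iic_union_Ici (a := (0 : ℝ)), max_self]
    refine HasDerivWithinAt.union ?_ ?_
    · refine HasDerivWithinAt.congr (f := fun _ => (0 : ℝ)) ?_ ?_ ?_
      · simpa using hasDerivWithinAt_const (0 : ℝ) (Iic 0) (0 : ℝ)
      · intro z hz
        simp [max_eq_right (mem_Iic.1 hz)]
      · simp
    · refine hpow.hasDerivWithinAt.congr ?_ ?_
      · intro z hz
        simp [max_eq_left (mem_Ici.1 hz)]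
      · simp
  · rw [max_eq_left hy.le]
    refine hpow.congr_of_eventuallyEq ?_
    filter_upwards [Ioi_mem_nhds hy] with z hz
    simp [max_eq_left (mem_Ioi.1 hz).le]

theorem exists_delay_index {τ t : ℝ} {N : ℕ} (h₁ : -τ ≤ t) (h₂ : t < N * τ) :
    ∃ k ≤ N, ((k : ℝ) - 1) * τ ≤ t ∧ t < k * τ := by
  have hex : ∃ k : ℕ, t < k * τ := ⟨N, h₂⟩
  classical
  refine ⟨Nat.find hex, Nat.find_le h₂, ?_, Nat.find_spec hex⟩
  rcases hk : Nat.find hex with _ | k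
  · simpa using h₁
  · have := Nat.find_min hex (m := k) (by omega)
    push_cast
    linarith

theorem sum_pow_eq_sum_max_pow {τ t : ℝ} (hτ : 0 < τ) {k N : ℕ} (hkN : k ≤ N)
    (h₁ : ((k : ℝ) - 1) * τ ≤ t) (h₂ : t < k * τ) (a : ℕ → ℝ) (m : ℕ → ℕ) :
    ∑ j ∈ Finset.range k, a j * (t - j * τ) ^ (m j + 1) =
      ∑ j ∈ Finset.range N, a j * max (t - j * τ) 0 ^ (m j + 1) := by
  rw [← Finset.sum_subset (Finset.range_mono hkN)]
  · refine Finset.sum_congr rfl fun j hj => ?_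
    have hj' : (j : ℝ) + 1 ≤ k := by exact_mod_cast Finset.mem_range.1 hj
    rw [max_eq_left]
    nlinarith
  · intro j _ hj
    have hj' : (k : ℝ) ≤ j := by exact_mod_cast not_lt.1 (fun h => hj (Finset.mem_range.2 h))
    rw [max_eq_right (by nlinarith)]
    simp

/-- The delay cosine, continued by `1` to the left of `-τ`. -/
noncomputable def delayCosExt (τ : ℝ) (dc : ℝ → ℝ) (t : ℝ) : ℝ :=
  if t < -τ then 1 else dc t

/-- The delay sine, continued by its first affine piece to the left of `-τ`. -/
noncomputable def delaySinExt (τ ω : ℝ) (ds : ℝ → ℝ) (t : ℝ) : ℝ :=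
  if t < -τ then ω * (t + τ) else ds t

theorem sum_max_eq_zero {τ t : ℝ} (hτ : 0 < τ) (ht : t < -τ) (N : ℕ) (a : ℕ → ℝ) (m : ℕ → ℕ) :
    ∑ j ∈ Finset.range N, a j * max (t - j * τ) 0 ^ (m j + 1) = 0 := by
  refine Finset.sum_eq_zero fun j _ => ?_
  have : (0 : ℝ) ≤ j := j.cast_nonneg
  rw [max_eq_right (by nlinarith)]
  simp

section

variable {τ ω : ℝ} {dc ds : ℝ → ℝ}

theorem IsDelayCos.ext_eq_sum (hτ : 0 < τ) (hc : IsDelayCos τ ω dc) {N : ℕ} {t : ℝ}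
    (ht : t < N * τ) :
    delayCosExt τ dc t = 1 + ∑ j ∈ Finset.range N,
      ((-1) ^ (j + 1) * ω ^ (2 * j + 2) / ((2 * j + 2).factorial : ℝ)) *
        max (t - j * τ) 0 ^ (2 * j + 1 + 1) := by
  unfold delayCosExt
  split_ifs with h
  · rw [sum_max_eq_zero hτ h N _ (fun j => 2 * j + 1), add_zero]
  · obtain ⟨k, hkN, h₁, h₂⟩ := exists_delay_index (not_lt.1 h) ht
    rw [hc.2 k t h₁ h₂, ← sum_pow_eq_sum_max_pow hτ hkN h₁ h₂ _ (fun j => 2 * j + 1),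
      Finset.sum_range_succ', add_comm]
    congr 1
    · simp
    · refine Finset.sum_congr rfl fun j _ => ?_
      rw [show 2 * (j + 1) = 2 * j + 2 by ring]
      push_cast
      ring

theorem IsDelaySin.ext_eq_sum (hτ : 0 < τ) (hs : IsDelaySin τ ω ds) {N : ℕ} {t : ℝ}
    (ht : t < N * τ) :
    delaySinExt τ ω ds t = ω * (t + τ) + ∑ j ∈ Finset.range N,
      ((-1) ^ (j + 1) * ω ^ (2 * j + 3) / ((2 * j + 3).factorial : ℝ)) *
        max (t - j * τ) 0 ^ (2 * j + 2 + 1) := by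
  unfold delaySinExt
  split_ifs with h
  · rw [sum_max_eq_zero hτ h N _ (fun j => 2 * j + 2), add_zero]
  · obtain ⟨k, hkN, h₁, h₂⟩ := exists_delay_index (not_lt.1 h) ht
    rw [hs.2 k t h₁ h₂, ← sum_pow_eq_sum_max_pow hτ hkN h₁ h₂ _ (fun j => 2 * j + 2),
      Finset.sum_range_succ', add_comm]
    congr 1
    · simp
    · refine Finset.sum_congr rfl fun j _ => ?_
      rw [show 2 * (j + 1) + 1 = 2 * j + 3 by ring]
      push_cast
      ring

theorem IsDelaySin.eq_sum (hτ : 0 < τ) (hs : IsDelaySin τ ω ds) {N : ℕ} {t : ℝ}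
    (ht : t < ((N : ℝ) - 1) * τ) :
    ds t = ∑ j ∈ Finset.range N,
      ((-1) ^ j * ω ^ (2 * j + 1) / ((2 * j + 1).factorial : ℝ)) *
        max (t + τ - j * τ) 0 ^ (2 * j + 1) := by
  rcases lt_or_ge t (-τ) with h | h
  · rw [hs.1 t h]
    refine (Finset.sum_eq_zero fun j _ => ?_).symm
    have : (0 : ℝ) ≤ j := j.cast_nonneg
    rw [max_eq_right (by nlinarith)]
    simp
  · obtain _ | N := N
    · simp at ht; linarith
    push_cast at ht
    obtain ⟨k, hkN, h₁, h₂⟩ := exists_delay_index (N := N) h (by linarith)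
    rw [hs.2 k t h₁ h₂, ← sum_pow_eq_sum_max_pow (t := t + τ) (k := k + 1) hτ (by omega)
      (by push_cast; linarith) (by push_cast; linarith) _ (fun j => 2 * j)]
    refine Finset.sum_congr rfl fun j _ => ?_
    rw [show t - ((j : ℝ) - 1) * τ = t + τ - j * τ by ring]
    ring

theorem exists_nat_lt_mul (hτ : 0 < τ) (t : ℝ) : ∃ N : ℕ, t < N * τ := by
  obtain ⟨N, hN⟩ := exists_nat_gt (t / τ)
  exact ⟨N, (div_lt_iff₀ hτ).1 hN⟩

theorem hasDerivAt_sum_max_pow (N : ℕ) (a b : ℕ → ℝ) (m : ℕ → ℕ) (τ t : ℝ)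
    (hab : ∀ j, a j * (m j + 2) = b j) :
    HasDerivAt (fun t => ∑ j ∈ Finset.range N, a j * max (t - j * τ) 0 ^ (m j + 2))
      (∑ j ∈ Finset.range N, b j * max (t - j * τ) 0 ^ (m j + 1)) t := by
  refine HasDerivAt.fun_sum fun j _ => ?_
  have h := ((hasDerivAt_max_zero_pow (m j) (t - j * τ)).comp t
    ((hasDerivAt_id t).sub_const (j * τ))).const_mul (a j)
  rw [← hab, mul_assoc]
  simpa using h

theorem IsDelaySin.hasDerivAt_ext (hτ : 0 < τ) (hc : IsDelayCos τ ω dc)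
    (hs : IsDelaySin τ ω ds) (t : ℝ) :
    HasDerivAt (delaySinExt τ ω ds) (ω * delayCosExt τ dc t) t := by
  obtain ⟨N, hN⟩ := exists_nat_lt_mul hτ t
  have hlin : HasDerivAt (fun t => ω * (t + τ)) ω t := by
    simpa using ((hasDerivAt_id t).add_const τ).const_mul ω
  have h := hlin.add (hasDerivAt_sum_max_pow N
    (fun j => (-1) ^ (j + 1) * ω ^ (2 * j + 3) / ((2 * j + 3).factorial : ℝ))
    (fun j => ω * ((-1) ^ (j + 1) * ω ^ (2 * j + 2) / ((2 * j + 2).factorial : ℝ)))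
    (fun j => 2 * j + 1) τ t fun j => by
      rw [Nat.factorial_succ (2 * j + 2)]
      have : ((2 * j + 2).factorial : ℝ) ≠ 0 := by positivity
      push_cast
      field_simp
      ring)
  rw [hc.ext_eq_sum hτ hN, mul_add, mul_one, Finset.mul_sum]
  simp only [← mul_assoc] at h ⊢
  refine h.congr_of_eventuallyEq ?_
  filter_upwards [Iio_mem_nhds hN] with z hz
  exact hs.ext_eq_sum hτ hz

theorem IsDelayCos.hasDerivAt_ext (hτ : 0 < τ) (hc : IsDelayCos τ ω dc)
    (hs : IsDelaySin τ ω ds) (t : ℝ) :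
    HasDerivAt (delayCosExt τ dc) (-(ω * ds (t - τ))) t := by
  obtain ⟨N, hN⟩ := exists_nat_lt_mul hτ t
  have h := (hasDerivAt_sum_max_pow N
    (fun j => (-1) ^ (j + 1) * ω ^ (2 * j + 2) / ((2 * j + 2).factorial : ℝ))
    (fun j => -(ω * ((-1) ^ j * ω ^ (2 * j + 1) / ((2 * j + 1).factorial : ℝ))))
    (fun j => 2 * j) τ t fun j => by
      rw [Nat.factorial_succ (2 * j + 1)]
      have : ((2 * j + 1).factorial : ℝ) ≠ 0 := by positivity
      push_cast
      field_simp
      ring).const_add 1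
  rw [hs.eq_sum (N := N) hτ (by linarith), Finset.mul_sum, ← Finset.sum_neg_distrib]
  simp only [neg_mul, ← mul_assoc, sub_add_cancel] at h ⊢
  refine h.congr_of_eventuallyEq ?_
  filter_upwards [Iio_mem_nhds hN] with z hz
  simpa only [neg_mul] using hc.ext_eq_sum hτ hz

theorem IsDelaySin.eq_of_mem_Ico (hs : IsDelaySin τ ω ds) {t : ℝ} (h₁ : -τ ≤ t) (h₂ : t < 0) :
    ds t = ω * (t + τ) := by
  simpa using hs.2 0 t (by simpa using h₁) (by simpa using h₂)

theorem IsDelayCos.eq_of_mem_Ico (hc : IsDelayCos τ ω dc) {t : ℝ} (h₁ : -τ ≤ t) (h₂ : t < 0) :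
    dc t = 1 := by
  simpa using hc.2 0 t (by simpa using h₁) (by simpa using h₂)

theorem IsDelaySin.eq_zero (hτ : 0 < τ) (hs : IsDelaySin τ ω ds) {t : ℝ} (ht : t ≤ -τ) :
    ds t = 0 := by
  rcases ht.lt_or_eq with h | rfl
  · exact hs.1 t h
  · simp [hs.eq_of_mem_Ico le_rfl (neg_lt_zero.2 hτ)]

theorem delaySinExt_of_le {t : ℝ} (ht : -τ ≤ t) : delaySinExt τ ω ds t = ds t :=
  if_neg ht.not_gt

theorem delayCosExt_of_le {t : ℝ} (ht : -τ ≤ t) : delayCosExt τ dc t = dc t :=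
  if_neg ht.not_gt

theorem IsDelayCos.ext_eq_one (hτ : 0 < τ) (hc : IsDelayCos τ ω dc) {t : ℝ} (ht : t ≤ 0) :
    delayCosExt τ dc t = 1 := by
  simpa using hc.ext_eq_sum (N := 0 + 1) (t := t) hτ (by simp; linarith) |>.trans (by simp [ht])

theorem IsDelaySin.continuous (hτ : 0 < τ) (hc : IsDelayCos τ ω dc) (hs : IsDelaySin τ ω ds) :
    Continuous ds := by
  have hT : Continuous (delaySinExt τ ω ds) :=
    continuous_iff_continuousAt.2 fun t => (hs.hasDerivAt_ext hτ hc t).continuousAt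
  have : ds = fun t => delaySinExt τ ω ds (max t (-τ)) := by
    funext t
    rw [delaySinExt_of_le (le_max_right _ _)]
    rcases le_total t (-τ) with h | h
    · rw [max_eq_right h, hs.eq_zero hτ h, hs.eq_zero hτ le_rfl]
    · rw [max_eq_left h]
  rw [this]
  fun_prop

end

/-- Differentiation under the integral sign for a convolution with a `C¹` kernel. -/
theorem hasDerivAt_integral_comp_sub_mul {F F' b : ℝ → ℝ} {a c : ℝ} (hac : a ≤ c)
    (hF : ∀ t, HasDerivAt F (F' t) t) (hF' : Continuous F') (hb : ContinuousOn b (Icc a c))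
    (t₀ : ℝ) :
    HasDerivAt (fun t => ∫ s in a..c, F (t - s) * b s) (∫ s in a..c, F' (t₀ - s) * b s) t₀ := by
  have hFc : Continuous F := continuous_iff_continuousAt.2 fun t => (hF t).continuousAt
  have hb' : ContinuousOn b (uIcc a c) := by rwa [uIcc_of_le hac]
  have hint : ∀ {G : ℝ → ℝ}, Continuous G → ∀ t,
      IntervalIntegrable (fun s => G (t - s) * b s) volume a c := fun hG t =>
    ((hG.comp (continuous_const.sub continuous_id)).continuousOn.mul hb').intervalIntegrable
  obtain ⟨M, hM⟩ := (isCompact_Icc (a := t₀ - 1 - c) (b := t₀ + 1 - a)).exists_bound_of_continuousOn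
    hF'.continuousOn
  refine (intervalIntegral.hasDerivAt_integral_of_dominated_loc_of_deriv_le
    (F := fun t s => F (t - s) * b s) (F' := fun t s => F' (t - s) * b s)
    (bound := fun s => M * ‖b s‖) (Metric.ball_mem_nhds t₀ one_pos)
    (Eventually.of_forall fun t => ?_) (hint hFc t₀) ?_
    (Eventually.of_forall fun s hs t ht => ?_) ?_
    (Eventually.of_forall fun s _ t _ => ?_)).2
  · exact (intervalIntegrable_iff.1 (hint hFc t)).aestronglyMeasurable
  · exact (intervalIntegrable_iff.1 (hint hF' t₀)).aestronglyMeasurable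
  · rw [norm_mul]
    rw [uIoc_of_le hac] at hs
    rw [Metric.mem_ball, Real.dist_eq, abs_lt] at ht
    gcongr
    exact hM _ ⟨by linarith [hs.2], by linarith [hs.1]⟩
  · exact (hb'.norm.const_mul M).intervalIntegrable
  · exact ((hF (t - s)).comp_sub_const t s).mul_const (b s)

/-- Taylor's formula of order two with integral remainder, on an interval `[a, u] ⊆ [a, c]`. -/
theorem taylor_two_integral_remainder {β β' β'' : ℝ → ℝ} {a c u : ℝ} (hau : a ≤ u) (huc : u ≤ c)
    (hβ' : ∀ t ∈ Icc a c, HasDerivWithinAt β (β' t) (Icc a c) t)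
    (hβ'' : ∀ t ∈ Icc a c, HasDerivWithinAt β' (β'' t) (Icc a c) t)
    (hβ''c : ContinuousOn β'' (Icc a c)) :
    β u = β a + (u - a) * β' a + ∫ s in a..u, (u - s) * β'' s := by
  have hsub : Icc a u ⊆ Icc a c := Icc_subset_Icc_right huc
  have hd : ∀ s ∈ Icc a c,
      HasDerivWithinAt (fun s => β s + (u - s) * β' s) ((u - s) * β'' s) (Icc a c) s := by
    intro s hs
    exact ((hβ' s hs).add
      (((hasDerivWithinAt_id s (Icc a c)).const_sub u).mul (hβ'' s hs))).congr_deriv (by simp)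
  have h := intervalIntegral.integral_eq_sub_of_hasDerivAt_of_le hau
    (f := fun s => β s + (u - s) * β' s) (f' := fun s => (u - s) * β'' s)
    (fun s hs => ((hd s (hsub hs)).continuousWithinAt).mono hsub)
    (fun s hs => (hd s (hsub (Ioo_subset_Icc_self hs))).hasDerivAt
      (Icc_mem_nhds hs.1 (hs.2.trans_le huc)))
    (ContinuousOn.intervalIntegrable (by
      rw [uIcc_of_le hau]
      exact (continuousOn_const.sub continuousOn_id).mul (hβ''c.mono hsub)))
  rw [h]
  ring

theorem IsDelaySin.integral_comp_mul_of_mem_Ico {τ ω : ℝ} {ds b : ℝ → ℝ} (hτ : 0 < τ)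
    (hdsc : Continuous ds) (hs : IsDelaySin τ ω ds) (hb : ContinuousOn b (Icc (-τ) 0)) {u : ℝ}
    (h₁ : -τ ≤ u) (h₂ : u < 0) :
    ∫ s in (-τ)..0, ds (u - τ - s) * b s = ω * ∫ s in (-τ)..u, (u - s) * b s := by
  have hint : ∀ p q, p ∈ Icc (-τ) 0 → q ∈ Icc (-τ) 0 →
      IntervalIntegrable (fun s => ds (u - τ - s) * b s) volume p q := fun p q hp hq =>
    ContinuousOn.intervalIntegrable <|
      (hdsc.comp (continuous_const.sub continuous_id)).continuousOn.mul
        (hb.mono (uIcc_subset_Icc hp hq))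
  rw [← intervalIntegral.integral_add_adjacent_intervals
    (hint (-τ) u ⟨le_rfl, by linarith⟩ ⟨h₁, h₂.le⟩) (hint u 0 ⟨h₁, h₂.le⟩ ⟨by linarith, le_rfl⟩),
    ← intervalIntegral.integral_const_mul]
  have hzero : ∫ s in u..0, ds (u - τ - s) * b s = ∫ s in u..0, (0 : ℝ) := by
    refine intervalIntegral.integral_congr fun s hs' => ?_
    rw [uIcc_of_le h₂.le] at hs'
    simp [hs.eq_zero hτ (t := u - τ - s) (by linarith [hs'.1])]
  rw [hzero, intervalIntegral.integral_zero, add_zero]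
  refine intervalIntegral.integral_congr fun s hs' => ?_
  rw [uIcc_of_le h₁] at hs'
  have h := hs.eq_of_mem_Ico (t := u - τ - s) (by linarith [hs'.2]) (by linarith [hs'.1])
  simp only [h]
  ring

/-- **Representation formula for the homogeneous pure-delay oscillator** (Equation (2.7)):
for a twice continuously differentiable history `β` on `[-τ, 0]` (with derivatives `β'`,
`β''`), the function `x` equal to `β` on `[-τ, 0]` and to
`β(-τ) cos_τ(ω,t) + (1/ω) β'(-τ) sin_τ(ω,t) + (1/ω) ∫_{-τ}^0 sin_τ(ω, t-τ-s) β''(s) ds`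
for `t ≥ 0` is continuous on `[-τ, ∞)`, is continuously differentiable at `t = 0` in the
sense that its right derivative at `0` equals `β'(0⁻)`, is twice differentiable at every
`t > 0`, and satisfies `x''(t) + ω² x(t - τ) = 0` for all `t > 0`. -/
theorem delay_oscillator_representation (τ ω : ℝ) (hτ : 0 < τ) (hω : 0 < ω)
    (dc ds : ℝ → ℝ) (hc : IsDelayCos τ ω dc) (hs : IsDelaySin τ ω ds)
    (β β' β'' : ℝ → ℝ)
    (hβ' : ∀ t ∈ Set.Icc (-τ) (0 : ℝ), HasDerivWithinAt β (β' t) (Set.Icc (-τ) 0) t)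
    (hβ'' : ∀ t ∈ Set.Icc (-τ) (0 : ℝ), HasDerivWithinAt β' (β'' t) (Set.Icc (-τ) 0) t)
    (hβ''c : ContinuousOn β'' (Set.Icc (-τ) 0))
    (x : ℝ → ℝ)
    (hx_hist : ∀ t ∈ Set.Icc (-τ) (0 : ℝ), x t = β t)
    (hx_rep : ∀ t ∈ Set.Ici (0 : ℝ), x t =
      β (-τ) * dc t + 1 / ω * β' (-τ) * ds t +
        1 / ω * ∫ s in (-τ)..(0 : ℝ), ds (t - τ - s) * β'' s) :
    ContinuousOn x (Set.Ici (-τ)) ∧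
    HasDerivWithinAt x (β' 0) (Set.Ici 0) 0 ∧
    ∃ x' : ℝ → ℝ,
      (∀ t ∈ Set.Ioi (0 : ℝ), HasDerivAt x (x' t) t) ∧
      ∀ t ∈ Set.Ioi (0 : ℝ), HasDerivAt x' (-(ω ^ 2 * x (t - τ))) t := by
  have hdsc : Continuous ds := hs.continuous hτ hc
  have hτ₀ : -τ ≤ 0 := by linarith
  set D := delayCosExt τ dc with hDdef
  set T := delaySinExt τ ω ds with hTdef
  have hD : ∀ t, HasDerivAt D (-(ω * ds (t - τ))) t := hc.hasDerivAt_ext hτ hs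
  have hT : ∀ t, HasDerivAt T (ω * D t) t := hs.hasDerivAt_ext hτ hc
  have hDc : Continuous D := continuous_iff_continuousAt.2 fun t => (hD t).continuousAt
  have hrep : ∀ u, -τ < u → x u = β (-τ) * dc u + 1 / ω * β' (-τ) * ds u +
      1 / ω * ∫ s in (-τ)..(0 : ℝ), ds (u - τ - s) * β'' s := by
    intro u hu
    rcases lt_or_ge u 0 with h | h
    · rw [hx_hist u ⟨hu.le, h.le⟩, hc.eq_of_mem_Ico hu.le h, hs.eq_of_mem_Ico hu.le h,
        hs.integral_comp_mul_of_mem_Ico hτ hdsc hβ''c hu.le h,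
        taylor_two_integral_remainder hu.le h.le hβ' hβ'' hβ''c]
      field_simp
      ring
    · exact hx_rep u h
  let X : ℝ → ℝ := fun t => β (-τ) * D t + 1 / ω * β' (-τ) * T t +
    1 / ω * ∫ s in (-τ)..(0 : ℝ), T (t - s - τ) * β'' s
  let X' : ℝ → ℝ := fun t => β (-τ) * -(ω * ds (t - τ)) + β' (-τ) * D t +
    ∫ s in (-τ)..(0 : ℝ), D (t - s - τ) * β'' s
  have hxX : ∀ t ∈ Ici (0 : ℝ), x t = X t := by
    intro t ht
    rw [mem_Ici] at ht
    simp only [X]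
    rw [hx_rep t ht, hDdef, hTdef, delayCosExt_of_le (by linarith),
      delaySinExt_of_le (by linarith)]
    congr 2
    refine intervalIntegral.integral_congr fun s hs' => ?_
    rw [uIcc_of_le hτ₀] at hs'
    have h : delaySinExt τ ω ds (t - s - τ) = ds (t - s - τ) :=
      delaySinExt_of_le (by linarith [hs'.2])
    simp only [h, sub_right_comm t τ s]
  have hX : ∀ t, HasDerivAt X (X' t) t := by
    intro t
    have h : HasDerivAt X _ t := (((hD t).const_mul (β (-τ))).add ((hT t).const_mul (1 / ω * β' (-τ)))).add
      ((hasDerivAt_integral_comp_sub_mul (F := fun t => T (t - τ))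
        (F' := fun t => ω * D (t - τ)) hτ₀ (fun t => (hT (t - τ)).comp_sub_const t τ)
        (by fun_prop) hβ''c t).const_mul (1 / ω))
    refine h.congr_deriv ?_
    simp only [X', mul_assoc, intervalIntegral.integral_const_mul]
    field_simp
  have hX' : ∀ t ∈ Ioi (0 : ℝ), HasDerivAt X' (-(ω ^ 2 * x (t - τ))) t := by
    intro t ht
    rw [mem_Ioi] at ht
    have hds : HasDerivAt ds (ω * D (t - τ)) (t - τ) := by
      refine (hT (t - τ)).congr_of_eventuallyEq ?_
      filter_upwards [Ioi_mem_nhds (show -τ < t - τ by linarith)] with z hz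
      exact (delaySinExt_of_le (le_of_lt hz)).symm
    have h : HasDerivAt X' _ t := (((((hds.comp_sub_const t τ).const_mul ω).neg).const_mul (β (-τ))).add
      ((hD t).const_mul (β' (-τ)))).add
      (hasDerivAt_integral_comp_sub_mul (F := fun t => D (t - τ))
        (F' := fun t => -(ω * ds (t - τ - τ))) hτ₀ (fun t => (hD (t - τ)).comp_sub_const t τ)
        (by fun_prop) hβ''c t)
    refine h.congr_deriv ?_
    rw [hrep (t - τ) (by linarith), hDdef, delayCosExt_of_le (by linarith)]
    simp only [neg_mul, mul_assoc, intervalIntegral.integral_const_mul,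
      intervalIntegral.integral_neg]
    have : ∀ s, t - s - τ - τ = t - τ - τ - s := fun s => by ring
    simp only [this]
    field_simp
    ring
  have hX'0 : X' 0 = β' 0 := by
    have hcongr : ∫ s in (-τ)..(0 : ℝ), D (0 - s - τ) * β'' s = ∫ s in (-τ)..(0 : ℝ), β'' s := by
      refine intervalIntegral.integral_congr fun s hs' => ?_
      rw [uIcc_of_le hτ₀] at hs'
      have h : D (0 - s - τ) = 1 := hc.ext_eq_one hτ (by linarith [hs'.1])
      simp only [h, one_mul]
    have hftc := intervalIntegral.integral_eq_sub_of_hasDerivAt_of_le hτ₀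
      (fun s hs' => (hβ'' s hs').continuousWithinAt)
      (fun s hs' => (hβ'' s (Ioo_subset_Icc_self hs')).hasDerivAt (Icc_mem_nhds hs'.1 hs'.2))
      (ContinuousOn.intervalIntegrable (by rwa [uIcc_of_le hτ₀]))
    simp only [X']
    rw [hcongr, hftc, hDdef, hc.ext_eq_one hτ le_rfl, hs.eq_zero hτ (by linarith)]
    ring
  refine ⟨?_, ?_, X', fun t ht => ?_, hX'⟩
  · rw [← Icc_union_Ici_eq_Ici hτ₀]
    refine ContinuousOn.union_of_isClosed ?_ ?_ isClosed_Icc isClosed_Ici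
    · exact ContinuousOn.congr (fun t ht => (hβ' t ht).continuousWithinAt) hx_hist
    · exact ContinuousOn.congr (fun t _ => (hX t).continuousAt.continuousWithinAt) hxX
  · rw [← hX'0]
    exact (hX 0).hasDerivWithinAt.congr hxX (hxX 0 self_mem_Ici)
  · refine (hX t).congr_of_eventuallyEq ?_
    filter_upwards [Ioi_mem_nhds ht] with z hz
    exact hxX z (mem_Ici.2 (mem_Ioi.1 hz).le)
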